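/- arXiv:2012.06433 — 10 statements merged into one kernel-verified Lean document; each statement's English description precedes it below -/
import Mathlib

section
/- Let V ≥ 1, W₀ ≥ 1, W ≥ 2, M ≥ 1 be natural numbers with M·W₀ ≤ V·(W−1), and set p* = 1/(V·(W−1)+1−W₀). Then (V·(W−1)/(2·W₀))·(1 − (1−p*)^(M·W₀)) ≥ M/4. -/
/-- Truncated Bernoulli bound: `n` independent trials of success probability `p ≥ t / n`, with
`t ≤ 1`, succeed at least once with probability at least `t / 2`. -/
theorem half_le_one_sub_one_sub_pow {p t : ℝ} {n : ℕ} (hp₀ : 0 ≤ p) (hp₁ : p ≤ 1)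
    (ht₀ : 0 ≤ t) (ht₁ : t ≤ 1) (h : t ≤ n * p) : t / 2 ≤ 1 - (1 - p) ^ n := by
  have hq : 0 ≤ (1 - p) ^ n := pow_nonneg (by linarith) n
  have hb : 1 + (n : ℝ) * p ≤ (1 + p) ^ n := one_add_mul_le_pow (by linarith) n
  have hprod : (1 - p) ^ n * (1 + p) ^ n ≤ 1 := by
    rw [← mul_pow]
    exact pow_le_one₀ (mul_nonneg (by linarith) (by linarith)) (by nlinarith)
  have hqt : (1 - p) ^ n * (1 + t) ≤ 1 :=
    (mul_le_mul_of_nonneg_left (by linarith) hq).trans hprod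
  have hle : (1 - p) ^ n ≤ 1 / (1 + t) := (le_div_iff₀ (by linarith)).2 hqt
  have hdiv : 1 / (1 + t) ≤ 1 - t / 2 := by
    rw [div_le_iff₀ (by linarith)]
    nlinarith
  linarith

/-- Proposition (small `M`): if `M·W₀ ≤ V·(W−1)` then the randomized lower bound
`(V·(W−1)/(2·W₀))·(1 − (1−p*)^(M·W₀))` is at least `M/4`,
where `p* = 1/(V·(W−1)+1−W₀)`. -/
theorem stmt_1 (V W₀ W M : ℕ) (hV : 1 ≤ V) (hW₀ : 1 ≤ W₀) (hW : 2 ≤ W) (hM : 1 ≤ M)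
    (hle : M * W₀ ≤ V * (W - 1)) :
    ((V : ℝ) * ((W : ℝ) - 1) / (2 * (W₀ : ℝ))) *
        (1 - (1 - 1 / ((V : ℝ) * ((W : ℝ) - 1) + 1 - (W₀ : ℝ))) ^ (M * W₀))
      ≥ (M : ℝ) / 4 := by
  have hW' : ((W - 1 : ℕ) : ℝ) = (W : ℝ) - 1 := by
    rw [Nat.cast_sub (by omega), Nat.cast_one]
  have hle' : (M : ℝ) * W₀ ≤ (V : ℝ) * ((W : ℝ) - 1) := by
    rw [← hW']
    exact_mod_cast hle
  have hW₀' : (1 : ℝ) ≤ W₀ := by exact_mod_cast hW₀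
  have hM' : (1 : ℝ) ≤ M := by exact_mod_cast hM
  generalize (V : ℝ) * ((W : ℝ) - 1) = A at hle' ⊢
  have hWA : (W₀ : ℝ) ≤ A := by nlinarith
  have hA : 0 < A := by linarith
  have hD : 1 ≤ A + 1 - (W₀ : ℝ) := by linarith
  have key := half_le_one_sub_one_sub_pow (p := 1 / (A + 1 - (W₀ : ℝ)))
    (t := (M : ℝ) * W₀ / A) (n := M * W₀) (by positivity)
    ((div_le_one (by linarith)).2 hD) (by positivity) ((div_le_one hA).2 hle') (by
      push_cast
      rw [mul_one_div]
      exact div_le_div_of_nonneg_left (by positivity) (by linarith) (by linarith))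
  calc (M : ℝ) / 4 = A / (2 * (W₀ : ℝ)) * ((M : ℝ) * W₀ / A / 2) := by
        field_simp
        norm_num
    _ ≤ _ := mul_le_mul_of_nonneg_left key (by positivity)
end

section
/- Let V ≥ 1, W₀ ≥ 1, W ≥ 2, M ≥ 1 be natural numbers with W₀ ≤ V·(W−1) and M·W₀ > V·(W−1), and set p* = 1/(V·(W−1)+1−W₀). Then (V·(W−1)/(2·W₀))·(1 − (1−p*)^(M·W₀)) > ((e−1)/(4·e))·(V·W/W₀), where e = exp(1). -/
/-- Proposition (large `M`): if `W₀ ≤ V·(W−1) < M·W₀` then the randomized lower bound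
`(V·(W−1)/(2·W₀))·(1 − (1−p*)^(M·W₀))` exceeds `((e−1)/(4e))·(V·W/W₀)`,
where `p* = 1/(V·(W−1)+1−W₀)` and `e = exp 1`. -/
theorem stmt_2 (V W₀ W M : ℕ) (hV : 1 ≤ V) (hW₀ : 1 ≤ W₀) (hW : 2 ≤ W) (hM : 1 ≤ M)
    (hle : W₀ ≤ V * (W - 1)) (hgt : V * (W - 1) < M * W₀) :
    ((V : ℝ) * ((W : ℝ) - 1) / (2 * (W₀ : ℝ))) *
        (1 - (1 - 1 / ((V : ℝ) * ((W : ℝ) - 1) + 1 - (W₀ : ℝ))) ^ (M * W₀))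
      > ((Real.exp 1 - 1) / (4 * Real.exp 1)) * ((V : ℝ) * (W : ℝ) / (W₀ : ℝ)) := by
  have hWr : (2 : ℝ) ≤ W := by exact_mod_cast hW
  have hVr : (1 : ℝ) ≤ V := by exact_mod_cast hV
  have hW₀r : (1 : ℝ) ≤ W₀ := by exact_mod_cast hW₀
  have hcast : ((V * (W - 1) : ℕ) : ℝ) = (V : ℝ) * ((W : ℝ) - 1) := by
    rw [Nat.cast_mul, Nat.cast_sub (by omega), Nat.cast_one]
  have hler : (W₀ : ℝ) ≤ (V : ℝ) * ((W : ℝ) - 1) := by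
    rw [← hcast]; exact_mod_cast hle
  have hgtr : (V : ℝ) * ((W : ℝ) - 1) < ((M * W₀ : ℕ) : ℝ) := by
    rw [← hcast]; exact_mod_cast hgt
  set D : ℝ := (V : ℝ) * ((W : ℝ) - 1) + 1 - (W₀ : ℝ) with hD
  have hD1 : 1 ≤ D := by linarith
  have hpow : (1 - 1 / D) ^ (M * W₀) < Real.exp (-1) :=
    calc (1 - 1 / D) ^ (M * W₀) ≤ Real.exp (-(1 / D)) ^ (M * W₀) := by
          have h1 : 1 / D ≤ 1 := by rw [div_le_one (by linarith)]; exact hD1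
          exact pow_le_pow_left₀ (by linarith) (Real.one_sub_le_exp_neg _) _
      _ = Real.exp (((M * W₀ : ℕ) : ℝ) * -(1 / D)) := (Real.exp_nat_mul _ _).symm
      _ < Real.exp (-1) := by
          have h1 : 1 < ((M * W₀ : ℕ) : ℝ) / D := by
            rw [one_lt_div (by linarith)]; linarith
          rw [Real.exp_lt_exp, mul_neg, mul_one_div]
          linarith
  have hexp : Real.exp (-1) < 1 := by rw [Real.exp_lt_one_iff]; norm_num
  have hfactor : (V : ℝ) * W / (4 * W₀) ≤ (V : ℝ) * ((W : ℝ) - 1) / (2 * (W₀ : ℝ)) := by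
    rw [div_le_div_iff₀ (by positivity) (by positivity)]
    have h : 0 ≤ (V : ℝ) * W₀ * ((W : ℝ) - 2) :=
      mul_nonneg (by positivity) (by linarith)
    linarith
  calc ((Real.exp 1 - 1) / (4 * Real.exp 1)) * ((V : ℝ) * (W : ℝ) / (W₀ : ℝ))
      = (V : ℝ) * W / (4 * W₀) * (1 - Real.exp (-1)) := by
        rw [Real.exp_neg]
        field_simp
    _ < (V : ℝ) * W / (4 * W₀) * (1 - (1 - 1 / D) ^ (M * W₀)) :=
        mul_lt_mul_of_pos_left (by linarith) (by positivity)
    _ ≤ _ := mul_le_mul_of_nonneg_right hfactor (by linarith)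
end

section
/- Let V ≥ 1, W ≥ 2, M ≥ 1 be natural numbers, and set p* = 1/(V·(W−1)). Then (V·(W−1)/2)·(1 − (1−p*)^M) ≥ (1/4)·min{ M, ((e−1)/e)·V·W }, where e = exp(1). -/
/-- Chord bound for `1 - exp (-x)` on the unit interval. -/
theorem half_le_one_sub_exp_neg {x : ℝ} (hx0 : 0 ≤ x) (hx1 : x ≤ 1) :
    x / 2 ≤ 1 - Real.exp (-x) := by
  have h : Real.exp (-x) * (x + 1) ≤ 1 := by
    calc Real.exp (-x) * (x + 1) ≤ Real.exp (-x) * Real.exp x := by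
          gcongr
          exact Real.add_one_le_exp x
      _ = 1 := by rw [← Real.exp_add]; simp
  nlinarith [mul_nonneg hx0 (sub_nonneg.2 hx1)]

theorem one_sub_one_div_pow_le_exp {n : ℝ} (hn : 1 ≤ n) (M : ℕ) :
    (1 - 1 / n) ^ M ≤ Real.exp (-(M / n)) := by
  have h0 : 0 ≤ 1 - 1 / n := by
    rw [sub_nonneg, div_le_one (by linarith)]
    exact hn
  calc (1 - 1 / n) ^ M ≤ Real.exp (-(1 / n)) ^ M := by
        gcongr
        exact Real.one_sub_le_exp_neg _
    _ = Real.exp (-(M / n)) := by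
        rw [← Real.exp_nat_mul]
        congr 1
        ring

/-- Corollary (`W₀ = 1`): with `p* = 1/(V·(W−1))`, the randomized lower bound
`(V·(W−1)/2)·(1 − (1−p*)^M)` is at least `(1/4)·min{M, ((e−1)/e)·V·W}`. -/
theorem stmt_3 (V W M : ℕ) (hV : 1 ≤ V) (hW : 2 ≤ W) (hM : 1 ≤ M) :
    ((V : ℝ) * ((W : ℝ) - 1) / 2) *
        (1 - (1 - 1 / ((V : ℝ) * ((W : ℝ) - 1))) ^ M)
      ≥ (1 / 4) *
        min (M : ℝ) (((Real.exp 1 - 1) / Real.exp 1) * (V : ℝ) * (W : ℝ)) := by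
  have hV' : (1 : ℝ) ≤ V := by exact_mod_cast hV
  have hW' : (2 : ℝ) ≤ W := by exact_mod_cast hW
  have hVW : (V : ℝ) * W ≤ 2 * (V * (W - 1)) := by nlinarith
  have hn : (1 : ℝ) ≤ V * (W - 1) := by nlinarith
  generalize (V : ℝ) * ((W : ℝ) - 1) = n at hVW hn ⊢
  have hn0 : 0 < n := by linarith
  have hpow := one_sub_one_div_pow_le_exp hn M
  rcases le_total (M : ℝ) n with h | h
  · have hchord := half_le_one_sub_exp_neg (x := M / n) (by positivity) ((div_le_one hn0).2 h)
    calc (1 / 4) * min (M : ℝ) _ ≤ (1 / 4) * M := by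
          gcongr
          exact min_le_left _ _
      _ = n / 2 * (M / n / 2) := by field_simp; norm_num
      _ ≤ n / 2 * (1 - (1 - 1 / n) ^ M) := by
          gcongr
          linarith
  · have hexp : Real.exp (-(M / n)) ≤ Real.exp (-1) :=
      Real.exp_le_exp.2 (neg_le_neg ((one_le_div hn0).2 h))
    have he : (Real.exp 1 - 1) / Real.exp 1 = 1 - Real.exp (-1) := by
      rw [Real.exp_neg]
      field_simp
    have he0 : 0 ≤ 1 - Real.exp (-1) := by
      rw [sub_nonneg, Real.exp_le_one_iff]
      norm_num
    rw [he]
    calc (1 / 4) * min (M : ℝ) _ ≤ (1 / 4) * ((1 - Real.exp (-1)) * V * W) := by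
          gcongr
          exact min_le_right _ _
      _ = (1 / 4) * ((1 - Real.exp (-1)) * (V * W)) := by ring
      _ ≤ (1 / 4) * ((1 - Real.exp (-1)) * (2 * n)) := by gcongr
      _ = n / 2 * (1 - Real.exp (-1)) := by ring
      _ ≤ n / 2 * (1 - (1 - 1 / n) ^ M) := by
          gcongr
          linarith
end

section
/- Let N be a finite set of datastores with access costs c_j > 0 and misindication ratios ρ_j ∈ [0,1], let β ≥ 0, let m = |N|, and let ℓ_1,…,ℓ_m enumerate N in non-decreasing order of misindication ratio. For 1 ≤ k ≤ m set D_k = {ℓ_1,…,ℓ_k} and P(k) = L_k + β·∏_{j=1}^{k} ρ_{ℓ_j}, and let k̂ ∈ {1,…,m} be an index minimizing P(k). Then for every nonempty subset D* ⊆ N, φ(D_{k̂}) ≤ (H_{k̂}/L_{k̂})·φ(D*). -/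
open Finset in
/-- The sum of the first `#S` values of a monotone function is at most its sum over `S`. -/
theorem sum_range_card_le_sum_of_monotoneOn {m : ℕ} {f : ℕ → ℝ}
    (hf : ∀ i j, i < m → j < m → i ≤ j → f i ≤ f j) (S : Finset ℕ) (hS : S ⊆ range m) :
    ∑ i ∈ range #S, f i ≤ ∑ i ∈ S, f i := by
  induction S using Finset.induction_on_max with
  | empty => simp
  | insert a s ha ih =>
    have has : a ∉ s := fun h => (ha a h).false
    have hcard : #s ≤ a := by
      simpa using card_le_card (fun x hx => mem_range.2 (ha x hx) : s ⊆ range a)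
    have ham : a < m := mem_range.1 (hS (mem_insert_self a s))
    rw [card_insert_of_notMem has, sum_range_succ, sum_insert has, add_comm (f a)]
    exact add_le_add (ih ((subset_insert a s).trans hS)) (hf _ _ (hcard.trans_lt ham) ham hcard)

open Finset in
/-- The product of the first `#S` values of a nonnegative monotone function is at most its
product over `S`. -/
theorem prod_range_card_le_prod_of_monotoneOn {m : ℕ} {f : ℕ → ℝ}
    (hf : ∀ i j, i < m → j < m → i ≤ j → f i ≤ f j) (hf0 : ∀ i < m, 0 ≤ f i)
    (S : Finset ℕ) (hS : S ⊆ range m) :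
    ∏ i ∈ range #S, f i ≤ ∏ i ∈ S, f i := by
  induction S using Finset.induction_on_max with
  | empty => simp
  | insert a s ha ih =>
    have has : a ∉ s := fun h => (ha a h).false
    have hcard : #s ≤ a := by
      simpa using card_le_card (fun x hx => mem_range.2 (ha x hx) : s ⊆ range a)
    have ham : a < m := mem_range.1 (hS (mem_insert_self a s))
    have hs : s ⊆ range m := (subset_insert a s).trans hS
    rw [card_insert_of_notMem has, prod_range_succ, prod_insert has, mul_comm (f a)]
    exact mul_le_mul (ih hs) (hf _ _ (hcard.trans_lt ham) ham hcard)
      (hf0 _ (hcard.trans_lt ham)) (prod_nonneg fun i hi => hf0 i (mem_range.1 (hs hi)))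

open Finset in
/-- The sum of a monotone function over `S` is at most the sum of its last `#S` values. -/
theorem sum_le_sum_Ico_of_monotoneOn {m : ℕ} {f : ℕ → ℝ}
    (hf : ∀ i j, i < m → j < m → i ≤ j → f i ≤ f j) (S : Finset ℕ) (hS : S ⊆ range m) :
    ∑ i ∈ S, f i ≤ ∑ i ∈ Ico (m - #S) m, f i := by
  have h := sum_range_card_le_sum_of_monotoneOn hf (range m \ S) sdiff_subset
  rw [card_sdiff_of_subset hS, card_range] at h
  have h1 := sum_sdiff (f := f) hS
  have h2 := sum_range_add_sum_Ico f (Nat.sub_le m #S)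
  linarith

/-- A subset of an injectively enumerated finset is the image of a set of indices of the same
cardinality. -/
theorem exists_index_finset {ι : Type*} [DecidableEq ι] {N A : Finset ι} {m : ℕ} {e : ℕ → ι}
    (him : (Finset.range m).image e = N) (hinj : Set.InjOn e (Finset.range m)) (hA : A ⊆ N) :
    ∃ S ⊆ Finset.range m, S.card = A.card ∧ Set.InjOn e S ∧ S.image e = A := by
  subst him
  obtain ⟨S, hS, rfl⟩ := Finset.subset_image_iff.1 hA
  have hSinj : Set.InjOn e S := hinj.mono (by exact_mod_cast hS)
  exact ⟨S, by exact_mod_cast hS, (Finset.card_image_of_injOn hSinj).symm, hSinj, rfl⟩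


/-- Theorem (POT): let `ℓ` enumerate the datastores in non-decreasing order of
misindication ratio, `σ` in non-decreasing order of access cost, `L k`/`H k` the sums
of the `k` smallest/largest access costs, `P k = L k + β·∏_{j<k} ρ(ℓ j)` the potential,
and `k̂ ∈ {1,…,m}` a minimizer of `P`.  Then for every nonempty `D* ⊆ N`,
`φ(D_{k̂}) ≤ (H_{k̂}/L_{k̂})·φ(D*)`, where `φ(D) = Σ_{j∈D} c j + β·∏_{j∈D} ρ j`. -/
theorem stmt_9 {ι : Type*} [DecidableEq ι] (N : Finset ι) (c ρ : ι → ℝ) (β : ℝ)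
    (hc : ∀ j ∈ N, 0 < c j) (hρ : ∀ j ∈ N, ρ j ∈ Set.Icc (0 : ℝ) 1) (hβ : 0 ≤ β)
    (m : ℕ) (hm : m = N.card)
    (ℓ σ : ℕ → ι)
    (hℓim : (Finset.range m).image ℓ = N)
    (hℓinj : Set.InjOn ℓ (Finset.range m))
    (hℓmono : ∀ i j, i < m → j < m → i ≤ j → ρ (ℓ i) ≤ ρ (ℓ j))
    (hσim : (Finset.range m).image σ = N)
    (hσinj : Set.InjOn σ (Finset.range m))
    (hσmono : ∀ i j, i < m → j < m → i ≤ j → c (σ i) ≤ c (σ j))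
    (L H : ℕ → ℝ)
    (hL : ∀ k, L k = ∑ i ∈ Finset.range k, c (σ i))
    (hH : ∀ k, H k = ∑ i ∈ Finset.Ico (m - k) m, c (σ i))
    (P : ℕ → ℝ)
    (hP : ∀ k, P k = L k + β * ∏ i ∈ Finset.range k, ρ (ℓ i))
    (D : ℕ → Finset ι) (hD : ∀ k, D k = (Finset.range k).image ℓ)
    (khat : ℕ) (hk1 : 1 ≤ khat) (hk2 : khat ≤ m)
    (hmin : ∀ k, 1 ≤ k → k ≤ m → P khat ≤ P k)
    (Dstar : Finset ι) (hDsub : Dstar ⊆ N) (hDne : Dstar.Nonempty) :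
    (∑ j ∈ D khat, c j) + β * ∏ j ∈ D khat, ρ j
      ≤ (H khat / L khat) * ((∑ j ∈ Dstar, c j) + β * ∏ j ∈ Dstar, ρ j) := by
  have hℓN : ∀ i < m, ℓ i ∈ N := fun i hi =>
    hℓim ▸ Finset.mem_image_of_mem ℓ (Finset.mem_range.2 hi)
  have hσN : ∀ i < m, σ i ∈ N := fun i hi =>
    hσim ▸ Finset.mem_image_of_mem σ (Finset.mem_range.2 hi)
  have hℓk : Set.InjOn ℓ (Finset.range khat) :=
    hℓinj.mono (by exact_mod_cast Finset.range_subset_range.2 hk2)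
  have hDN : D khat ⊆ N := by
    rw [hD, ← hℓim]
    exact Finset.image_subset_image (Finset.range_subset_range.2 hk2)
  have hDcard : (D khat).card = khat := by
    rw [hD, Finset.card_image_of_injOn hℓk, Finset.card_range]
  have hDprod : ∏ j ∈ D khat, ρ j = ∏ i ∈ Finset.range khat, ρ (ℓ i) := by
    rw [hD, Finset.prod_image hℓk]
  have hLpos : 0 < L khat := by
    rw [hL]
    refine Finset.sum_pos (fun i hi => hc _ (hσN i ?_)) (Finset.nonempty_range_iff.2 (by omega))
    exact (Finset.mem_range.1 hi).trans_le hk2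
  have hDH : ∑ j ∈ D khat, c j ≤ H khat := by
    obtain ⟨S, hS, hcard, hinj, him⟩ := exists_index_finset hσim hσinj hDN
    rw [← him, Finset.sum_image hinj, hH, ← hDcard, ← hcard]
    exact sum_le_sum_Ico_of_monotoneOn (f := fun i => c (σ i)) hσmono S hS
  have hLH : L khat ≤ H khat := by
    refine le_trans ?_ hDH
    obtain ⟨S, hS, hcard, hinj, him⟩ := exists_index_finset hσim hσinj hDN
    rw [← him, Finset.sum_image hinj, hL, ← hDcard, ← hcard]
    exact sum_range_card_le_sum_of_monotoneOn (f := fun i => c (σ i)) hσmono S hS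
  have hLstar : L Dstar.card ≤ ∑ j ∈ Dstar, c j := by
    obtain ⟨S, hS, hcard, hinj, him⟩ := exists_index_finset hσim hσinj hDsub
    rw [← hcard, ← him, Finset.sum_image hinj, hL]
    exact sum_range_card_le_sum_of_monotoneOn (f := fun i => c (σ i)) hσmono S hS
  have hρstar : ∏ i ∈ Finset.range Dstar.card, ρ (ℓ i) ≤ ∏ j ∈ Dstar, ρ j := by
    obtain ⟨S, hS, hcard, hinj, him⟩ := exists_index_finset hℓim hℓinj hDsub
    rw [← hcard, ← him, Finset.prod_image hinj]
    exact prod_range_card_le_prod_of_monotoneOn (f := fun i => ρ (ℓ i)) hℓmono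
      (fun i hi => (hρ _ (hℓN i hi)).1) S hS
  have hPstar : P khat ≤ (∑ j ∈ Dstar, c j) + β * ∏ j ∈ Dstar, ρ j := by
    refine (hmin _ hDne.card_pos (hm ▸ Finset.card_le_card hDsub)).trans ?_
    rw [hP]
    gcongr
  have hmiss : 0 ≤ β * ∏ j ∈ D khat, ρ j :=
    mul_nonneg hβ (Finset.prod_nonneg fun j hj => (hρ j (hDN hj)).1)
  have hratio : 1 ≤ H khat / L khat := (one_le_div hLpos).2 hLH
  calc (∑ j ∈ D khat, c j) + β * ∏ j ∈ D khat, ρ j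
      ≤ H khat + H khat / L khat * (β * ∏ j ∈ D khat, ρ j) :=
        add_le_add hDH (le_mul_of_one_le_left hmiss hratio)
    _ = H khat / L khat * P khat := by
        rw [hP, ← hDprod, mul_add, div_mul_cancel₀ _ hLpos.ne']
    _ ≤ _ := mul_le_mul_of_nonneg_left hPstar (zero_le_one.trans hratio)
end

section
/- Let N be a finite set of datastores with access costs c_j satisfying 1 ≤ c_j for all j, misindication ratios ρ_j ∈ [0,1], and β ≥ 0; let m = |N|, let ℓ_1,…,ℓ_m enumerate N in non-decreasing order of misindication ratio, set D_k = {ℓ_1,…,ℓ_k} and P(k) = L_k + β·∏_{j=1}^{k} ρ_{ℓ_j}, and let k̂ ∈ {1,…,m} minimize P(k) over k ∈ {1,…,m}. Then for every nonempty subset D* ⊆ N, φ(D_{k̂}) ≤ (max_{j∈N} c_j)·φ(D*). -/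
/-- A finite set of values of an injective enumeration of `range m` is listed without repetition by
the enumeration at indices `e i ≥ i`. -/
theorem exists_index_ge_of_subset_image {ι : Type*} [DecidableEq ι] {m : ℕ} {τ : ℕ → ι}
    (hinj : Set.InjOn τ (Finset.range m)) {T : Finset ι}
    (hT : T ⊆ (Finset.range m).image τ) :
    ∃ e : Fin T.card → ℕ, (∀ i : Fin T.card, (i : ℕ) ≤ e i ∧ e i < m) ∧
      Function.Injective (fun i => τ (e i)) ∧ Finset.univ.image (fun i => τ (e i)) = T := by
  obtain ⟨S, hS, rfl⟩ := Finset.subset_image_iff.1 hT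
  have hSr : ∀ x ∈ S, x ∈ Finset.range m := fun x hx => hS hx
  have hcard : S.card = (S.image τ).card :=
    (Finset.card_image_of_injOn (hinj.mono fun x hx => hSr x hx)).symm
  have hmem := S.orderEmbOfFin_mem hcard
  refine ⟨S.orderEmbOfFin hcard, fun i => ⟨?_, Finset.mem_range.1 (hSr _ (hmem i))⟩, ?_, ?_⟩
  · obtain ⟨n, hn⟩ := i
    induction n with
    | zero => exact Nat.zero_le _
    | succ n ih =>
      have h := ih (Nat.lt_of_succ_lt hn)
      have hlt : S.orderEmbOfFin hcard ⟨n, Nat.lt_of_succ_lt hn⟩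
          < S.orderEmbOfFin hcard ⟨n + 1, hn⟩ :=
        (S.orderEmbOfFin hcard).strictMono (Fin.mk_lt_mk.2 n.lt_succ_self)
      exact Nat.succ_le_of_lt (lt_of_le_of_lt h hlt)
  · intro i j hij
    exact (S.orderEmbOfFin hcard).injective (hinj (hSr _ (hmem i)) (hSr _ (hmem j)) hij)
  · have h := S.image_orderEmbOfFin_univ hcard
    conv_rhs => rw [← h]
    rw [Finset.image_image]
    rfl

/-- Corollary (POT is a `max_j c_j`-approximation): with access costs `c j ≥ 1`,
the prefix `D_{k̂}` minimizing the potential `P k = L k + β·∏_{j<k} ρ(ℓ j)` over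
`k ∈ {1,…,m}` satisfies `φ(D_{k̂}) ≤ (max_{j∈N} c j)·φ(D*)` for every nonempty
`D* ⊆ N`, where `φ(D) = Σ_{j∈D} c j + β·∏_{j∈D} ρ j`. -/
theorem stmt_10 {ι : Type*} [DecidableEq ι] (N : Finset ι) (hN : N.Nonempty)
    (c ρ : ι → ℝ) (β : ℝ)
    (hc : ∀ j ∈ N, 1 ≤ c j) (hρ : ∀ j ∈ N, ρ j ∈ Set.Icc (0 : ℝ) 1) (hβ : 0 ≤ β)
    (m : ℕ) (hm : m = N.card)
    (ℓ σ : ℕ → ι)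
    (hℓim : (Finset.range m).image ℓ = N)
    (hℓinj : Set.InjOn ℓ (Finset.range m))
    (hℓmono : ∀ i j, i < m → j < m → i ≤ j → ρ (ℓ i) ≤ ρ (ℓ j))
    (hσim : (Finset.range m).image σ = N)
    (hσinj : Set.InjOn σ (Finset.range m))
    (hσmono : ∀ i j, i < m → j < m → i ≤ j → c (σ i) ≤ c (σ j))
    (L : ℕ → ℝ)
    (hL : ∀ k, L k = ∑ i ∈ Finset.range k, c (σ i))
    (P : ℕ → ℝ)
    (hP : ∀ k, P k = L k + β * ∏ i ∈ Finset.range k, ρ (ℓ i))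
    (D : ℕ → Finset ι) (hD : ∀ k, D k = (Finset.range k).image ℓ)
    (khat : ℕ) (hk1 : 1 ≤ khat) (hk2 : khat ≤ m)
    (hmin : ∀ k, 1 ≤ k → k ≤ m → P khat ≤ P k)
    (Dstar : Finset ι) (hDsub : Dstar ⊆ N) (hDne : Dstar.Nonempty) :
    (∑ j ∈ D khat, c j) + β * ∏ j ∈ D khat, ρ j
      ≤ (N.sup' hN c) * ((∑ j ∈ Dstar, c j) + β * ∏ j ∈ Dstar, ρ j) := by
  have hM : ∀ j ∈ N, c j ≤ N.sup' hN c := fun j hj => Finset.le_sup' c hj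
  have hM1 : 1 ≤ N.sup' hN c := by
    obtain ⟨j, hj⟩ := hN
    exact (hc j hj).trans (hM j hj)
  have hℓN : ∀ i < m, ℓ i ∈ N := fun i hi =>
    hℓim ▸ Finset.mem_image_of_mem ℓ (Finset.mem_range.2 hi)
  have hσN : ∀ i < m, σ i ∈ N := fun i hi =>
    hσim ▸ Finset.mem_image_of_mem σ (Finset.mem_range.2 hi)
  have hcard : Dstar.card ≤ m := hm ▸ Finset.card_le_card hDsub
  have hsum : L Dstar.card ≤ ∑ j ∈ Dstar, c j := by
    obtain ⟨e, he, hinj, him⟩ := exists_index_ge_of_subset_image hσinj (hσim.symm ▸ hDsub)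
    calc L Dstar.card = ∑ i : Fin Dstar.card, c (σ i) := by rw [hL, Finset.sum_range]
      _ ≤ ∑ i : Fin Dstar.card, c (σ (e i)) := Finset.sum_le_sum fun i _ =>
        hσmono _ _ (i.2.trans_le hcard) (he i).2 (he i).1
      _ = ∑ j ∈ Finset.univ.image (fun i => σ (e i)), c j :=
        (Finset.sum_image hinj.injOn).symm
      _ = ∑ j ∈ Dstar, c j := by rw [him]
  have hprod : ∏ i ∈ Finset.range Dstar.card, ρ (ℓ i) ≤ ∏ j ∈ Dstar, ρ j := by
    obtain ⟨e, he, hinj, him⟩ := exists_index_ge_of_subset_image hℓinj (hℓim.symm ▸ hDsub)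
    calc ∏ i ∈ Finset.range Dstar.card, ρ (ℓ i) = ∏ i : Fin Dstar.card, ρ (ℓ i) := by
          rw [Finset.prod_range]
      _ ≤ ∏ i : Fin Dstar.card, ρ (ℓ (e i)) := Finset.prod_le_prod
        (fun i _ => (hρ _ (hℓN _ (i.2.trans_le hcard))).1)
        fun i _ => hℓmono _ _ (i.2.trans_le hcard) (he i).2 (he i).1
      _ = ∏ j ∈ Finset.univ.image (fun i => ℓ (e i)), ρ j :=
        (Finset.prod_image hinj.injOn).symm
      _ = ∏ j ∈ Dstar, ρ j := by rw [him]
  have hopt : P khat ≤ (∑ j ∈ Dstar, c j) + β * ∏ j ∈ Dstar, ρ j := by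
    refine (hmin _ hDne.card_pos hcard).trans ?_
    rw [hP]
    gcongr
  have hinjk : Set.InjOn ℓ (Finset.range khat) :=
    hℓinj.mono (Finset.coe_subset.2 (Finset.range_subset_range.2 hk2))
  have hlt : ∀ i ∈ Finset.range khat, i < m := fun i hi => (Finset.mem_range.1 hi).trans_le hk2
  have hpnn : 0 ≤ β * ∏ i ∈ Finset.range khat, ρ (ℓ i) :=
    mul_nonneg hβ (Finset.prod_nonneg fun i hi => (hρ _ (hℓN i (hlt i hi))).1)
  have hcost : ∑ i ∈ Finset.range khat, c (ℓ i) ≤ N.sup' hN c * L khat := by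
    rw [hL, Finset.mul_sum]
    refine Finset.sum_le_sum fun i hi => (hM _ (hℓN i (hlt i hi))).trans ?_
    exact le_mul_of_one_le_right (zero_le_one.trans hM1) (hc _ (hσN i (hlt i hi)))
  rw [hD, Finset.sum_image hinjk, Finset.prod_image hinjk]
  calc _ ≤ N.sup' hN c * L khat + N.sup' hN c * (β * ∏ i ∈ Finset.range khat, ρ (ℓ i)) :=
        add_le_add hcost (le_mul_of_one_le_left hpnn hM1)
    _ = N.sup' hN c * P khat := by rw [hP, mul_add]
    _ ≤ _ := mul_le_mul_of_nonneg_left hopt (zero_le_one.trans hM1)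
end

section
/- Let N be a finite set of datastores with access costs c_j > 0 and misindication ratios ρ_j ∈ [0,1], let β ≥ 0, let m = |N|, and let ℓ_1,…,ℓ_m enumerate N in non-decreasing order of misindication ratio. Then for every subset D* ⊆ N with |D*| = k*, one has L_{k*} + β·∏_{j=1}^{k*} ρ_{ℓ_j} ≤ φ(D*); that is, the potential of the length-k* prefix lower-bounds the expected cost of every k*-element subset. -/
theorem Fin.val_le_of_strictMono {k : ℕ} {e : Fin k → ℕ} (he : StrictMono e) (i : Fin k) :
    (i : ℕ) ≤ e i := by
  obtain ⟨i, hi⟩ := i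
  induction i with
  | zero => exact Nat.zero_le _
  | succ n ih =>
    have hlt : e ⟨n, by omega⟩ < e ⟨n + 1, hi⟩ := he (Fin.mk_lt_mk.2 n.lt_succ_self)
    exact (ih (by omega)).trans_lt hlt

/-- A subset of an enumerated set can be enumerated so that its `i`-th element occurs
no earlier than position `i` of the given enumeration. -/
theorem Finset.exists_subenumeration {ι : Type*} [DecidableEq ι] {m : ℕ} {σ : ℕ → ι}
    (hinj : Set.InjOn σ (Finset.range m)) {D : Finset ι} (hD : D ⊆ (Finset.range m).image σ) :
    ∃ e : Fin D.card → ℕ, (∀ i : Fin D.card, (i : ℕ) ≤ e i ∧ e i < m) ∧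
      Function.Injective (σ ∘ e) ∧ Finset.univ.image (σ ∘ e) = D := by
  obtain ⟨A, hA, hAD⟩ := Finset.subset_image_iff.1 hD
  have hcard : A.card = D.card := by
    rw [← hAD, Finset.card_image_of_injOn (hinj.mono (by exact_mod_cast hA))]
  have hmem (i) : A.orderEmbOfFin hcard i ∈ Finset.range m := hA (A.orderEmbOfFin_mem hcard i)
  refine ⟨A.orderEmbOfFin hcard, fun i => ⟨?_, Finset.mem_range.1 (hmem i)⟩, ?_, ?_⟩
  · exact Fin.val_le_of_strictMono (A.orderEmbOfFin hcard).strictMono i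
  · intro i j hij
    exact (A.orderEmbOfFin hcard).injective (hinj (hmem i) (hmem j) hij)
  · rw [← Finset.image_image, Finset.image_orderEmbOfFin_univ, hAD]

/-- Lemma (Eq. (potential2)): the potential of the length-`k*` prefix of the
non-decreasing misindication-ratio order lower-bounds the expected cost of every
`k*`-element subset `D* ⊆ N`:
`L_{k*} + β·∏_{j<k*} ρ(ℓ j) ≤ φ(D*)`. -/
theorem stmt_11 {ι : Type*} [DecidableEq ι] (N : Finset ι) (c ρ : ι → ℝ) (β : ℝ)
    (hc : ∀ j ∈ N, 0 < c j) (hρ : ∀ j ∈ N, ρ j ∈ Set.Icc (0 : ℝ) 1) (hβ : 0 ≤ β)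
    (m : ℕ) (hm : m = N.card)
    (ℓ σ : ℕ → ι)
    (hℓim : (Finset.range m).image ℓ = N)
    (hℓinj : Set.InjOn ℓ (Finset.range m))
    (hℓmono : ∀ i j, i < m → j < m → i ≤ j → ρ (ℓ i) ≤ ρ (ℓ j))
    (hσim : (Finset.range m).image σ = N)
    (hσinj : Set.InjOn σ (Finset.range m))
    (hσmono : ∀ i j, i < m → j < m → i ≤ j → c (σ i) ≤ c (σ j))
    (L : ℕ → ℝ)
    (hL : ∀ k, L k = ∑ i ∈ Finset.range k, c (σ i))
    (Dstar : Finset ι) (hDsub : Dstar ⊆ N) (kstar : ℕ) (hk : Dstar.card = kstar) :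
    L kstar + β * ∏ i ∈ Finset.range kstar, ρ (ℓ i)
      ≤ (∑ j ∈ Dstar, c j) + β * ∏ j ∈ Dstar, ρ j := by
  subst hk
  have hsum : L Dstar.card ≤ ∑ j ∈ Dstar, c j := by
    obtain ⟨e, he, hinj, him⟩ := Finset.exists_subenumeration hσinj (hσim.symm ▸ hDsub)
    calc L Dstar.card = ∑ i : Fin Dstar.card, c (σ i) := by
          rw [hL, Finset.sum_range]
      _ ≤ ∑ i, c ((σ ∘ e) i) := Finset.sum_le_sum fun i _ =>
          hσmono _ _ ((he i).1.trans_lt (he i).2) (he i).2 (he i).1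
      _ = ∑ j ∈ Finset.univ.image (σ ∘ e), c j := (Finset.sum_image hinj.injOn).symm
      _ = ∑ j ∈ Dstar, c j := by rw [him]
  have hprod : ∏ i ∈ Finset.range Dstar.card, ρ (ℓ i) ≤ ∏ j ∈ Dstar, ρ j := by
    obtain ⟨e, he, hinj, him⟩ := Finset.exists_subenumeration hℓinj (hℓim.symm ▸ hDsub)
    calc ∏ i ∈ Finset.range Dstar.card, ρ (ℓ i) = ∏ i : Fin Dstar.card, ρ (ℓ i) :=
          Finset.prod_range _
      _ ≤ ∏ i, ρ ((ℓ ∘ e) i) := Finset.prod_le_prod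
          (fun i _ => (hρ _ (hℓim ▸ Finset.mem_image_of_mem ℓ
            (Finset.mem_range.2 ((he i).1.trans_lt (he i).2)))).1)
          fun i _ => hℓmono _ _ ((he i).1.trans_lt (he i).2) (he i).2 (he i).1
      _ = ∏ j ∈ Finset.univ.image (ℓ ∘ e), ρ j := (Finset.prod_image hinj.injOn).symm
      _ = ∏ j ∈ Dstar, ρ j := by rw [him]
  exact add_le_add hsum (mul_le_mul_of_nonneg_left hprod hβ)
end

section
/- Let N be a finite set of datastores with access costs c_j > 0 and misindication ratios ρ_j ∈ [0,1], and let β ≥ 0. Let D* ⊆ N minimize φ over all subsets of N. Suppose D ⊆ N satisfies Σ_{j∈D} c_j ≤ Σ_{j∈D*} c_j, and ∏_{j∈D} ρ_j ≤ ∏_{j∈D'} ρ_j for every subset D' ⊆ N with Σ_{j∈D'} c_j ≤ Σ_{j∈D*} c_j. Then φ(D) = φ(D*); that is, D also minimizes φ over all subsets of N. -/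
/-- Correctness claim of the knapsack-based algorithm `DSS_pp`: a subset `D` whose
access cost is within the optimum's budget and whose miss ratio is minimal among
all subsets within that budget is itself an optimal solution. -/
theorem stmt_12 {ι : Type*} [DecidableEq ι] (N : Finset ι) (c ρ : ι → ℝ) (β : ℝ)
    (hc : ∀ j ∈ N, 0 < c j) (hρ : ∀ j ∈ N, ρ j ∈ Set.Icc (0 : ℝ) 1) (hβ : 0 ≤ β)
    (φ : Finset ι → ℝ)
    (hφ : ∀ D, φ D = (∑ j ∈ D, c j) + β * ∏ j ∈ D, ρ j)
    (Dstar : Finset ι) (hDstar : Dstar ⊆ N)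
    (hopt : ∀ D' ⊆ N, φ Dstar ≤ φ D')
    (D : Finset ι) (hD : D ⊆ N)
    (hcost : ∑ j ∈ D, c j ≤ ∑ j ∈ Dstar, c j)
    (hρmin : ∀ D' ⊆ N, (∑ j ∈ D', c j ≤ ∑ j ∈ Dstar, c j) →
      ∏ j ∈ D, ρ j ≤ ∏ j ∈ D', ρ j) :
    φ D = φ Dstar := by
  refine le_antisymm ?_ (hopt D hD)
  rw [hφ, hφ]
  exact add_le_add hcost (mul_le_mul_of_nonneg_left (hρmin Dstar hDstar le_rfl) hβ)
end

section
/- Let N be a finite set of datastores with access costs c_j > 0 and misindication ratios ρ_j ∈ (0,1], let β ≥ 0, and let ε ≥ 0 be real. Let D* ⊆ N and let ℓ be a natural number with 2^{−(ℓ+1)} ≤ ∏_{j∈D*} ρ_j ≤ 2^{−ℓ}. Suppose D ⊆ N satisfies Σ_{j∈D} c_j ≤ Σ_{j∈D*} c_j and Σ_{j∈D} (−log₂ ρ_j) ≥ (1/(1+ε))·Σ_{j∈D*} (−log₂ ρ_j). Then φ(D) ≤ 2^{1 + ε·ℓ/(1+ε)}·φ(D*). -/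
/-- A product of positive reals is `2` to the minus its total log-hit weight. -/
theorem prod_eq_two_rpow_neg_sum_neg_logb {ι : Type*} (s : Finset ι) (ρ : ι → ℝ)
    (hρ : ∀ j ∈ s, 0 < ρ j) :
    ∏ j ∈ s, ρ j = (2 : ℝ) ^ (-∑ j ∈ s, (-(Real.logb 2 (ρ j)))) := by
  rw [Finset.sum_neg_distrib, neg_neg, Real.rpow_sum_of_pos two_pos]
  exact Finset.prod_congr rfl fun j hj =>
    (Real.rpow_logb two_pos (by norm_num) (hρ j hj)).symm

/-- Explicit-constant approximation guarantee for `DSS_pp` with a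
`(1+ε)`-approximate knapsack subroutine: if `D` respects the optimum's budget and
captures a `1/(1+ε)` fraction of the optimum's log-hit weight, then
`φ(D) ≤ 2^{1 + ε·ℓ/(1+ε)}·φ(D*)`, where `2^{−(ℓ+1)} ≤ ∏_{j∈D*} ρ j ≤ 2^{−ℓ}`. -/
theorem stmt_14 {ι : Type*} [DecidableEq ι] (N : Finset ι) (c ρ : ι → ℝ) (β ε : ℝ)
    (hc : ∀ j ∈ N, 0 < c j) (hρ : ∀ j ∈ N, ρ j ∈ Set.Ioc (0 : ℝ) 1)
    (hβ : 0 ≤ β) (hε : 0 ≤ ε)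
    (Dstar : Finset ι) (hDstar : Dstar ⊆ N) (ℓ : ℕ)
    (hlo : (2 : ℝ) ^ (-((ℓ : ℝ) + 1)) ≤ ∏ j ∈ Dstar, ρ j)
    (hhi : ∏ j ∈ Dstar, ρ j ≤ (2 : ℝ) ^ (-(ℓ : ℝ)))
    (D : Finset ι) (hD : D ⊆ N)
    (hcost : ∑ j ∈ D, c j ≤ ∑ j ∈ Dstar, c j)
    (hweight : (1 / (1 + ε)) * ∑ j ∈ Dstar, (-(Real.logb 2 (ρ j)))
      ≤ ∑ j ∈ D, (-(Real.logb 2 (ρ j)))) :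
    (∑ j ∈ D, c j) + β * ∏ j ∈ D, ρ j
      ≤ (2 : ℝ) ^ (1 + ε * (ℓ : ℝ) / (1 + ε)) *
          ((∑ j ∈ Dstar, c j) + β * ∏ j ∈ Dstar, ρ j) := by
  have hP := prod_eq_two_rpow_neg_sum_neg_logb Dstar ρ fun j hj => (hρ j (hDstar hj)).1
  have hQ := prod_eq_two_rpow_neg_sum_neg_logb D ρ fun j hj => (hρ j (hD hj)).1
  rw [hP, Real.rpow_le_rpow_left_iff one_lt_two] at hlo
  rw [hP, hQ]
  set W := ∑ j ∈ Dstar, (-(Real.logb 2 (ρ j)))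
  set V := ∑ j ∈ D, (-(Real.logb 2 (ρ j)))
  have hε' : 0 < 1 + ε := by linarith
  have hcstar : 0 ≤ ∑ j ∈ Dstar, c j :=
    Finset.sum_nonneg fun j hj => (hc j (hDstar hj)).le
  have hfactor : (1 : ℝ) ≤ 2 ^ (1 + ε * (ℓ : ℝ) / (1 + ε)) :=
    Real.one_le_rpow one_le_two (by positivity)
  have hexp : -V ≤ (1 + ε * (ℓ : ℝ) / (1 + ε)) + -W := by
    have hgap : W - 1 / (1 + ε) * W ≤ 1 + ε * (ℓ : ℝ) / (1 + ε) := by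
      have hW : W - 1 / (1 + ε) * W = ε * W / (1 + ε) := by field_simp; ring
      have hone : 1 + ε * (ℓ : ℝ) / (1 + ε) = (1 + ε + ε * ℓ) / (1 + ε) := by field_simp
      rw [hW, hone]
      gcongr
      nlinarith
    linarith
  have hmiss : (2 : ℝ) ^ (-V) ≤ 2 ^ (1 + ε * (ℓ : ℝ) / (1 + ε)) * 2 ^ (-W) := by
    rw [← Real.rpow_add two_pos]
    exact Real.rpow_le_rpow_of_exponent_le one_le_two hexp
  have hcost' := hcost.trans (le_mul_of_one_le_left hcstar hfactor)
  have hmiss' := mul_le_mul_of_nonneg_left hmiss hβ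
  linarith
end

section
/- Let P be a finite set of datastores, j a natural number, c : P → ℝ with 2^j ≤ c(d) < 2^{j+1} for every d ∈ P, and ρ : P → ℝ with 0 ≤ ρ(d) ≤ 1 for every d ∈ P. Let O ⊆ P with |O| = k, and let D ⊆ P with |D| = k be such that ρ(d) ≤ ρ(d') for every d ∈ D and every d' ∈ P \ D (i.e., D consists of k elements of P with the smallest misindication ratios). Then Σ_{d∈D} c(d) ≤ 2·Σ_{d∈O} c(d) and ∏_{d∈D} ρ(d) ≤ ∏_{d∈O} ρ(d). -/
/-- If two finsets have the same cardinality and every value of `f` on the first is at most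
every value on the second, then the products compare. -/
theorem Finset.prod_le_prod_of_card_eq_of_forall_le {ι : Type*} {s t : Finset ι} {f : ι → ℝ}
    (hcard : s.card = t.card) (hnonneg : ∀ x ∈ s, 0 ≤ f x)
    (hle : ∀ x ∈ s, ∀ y ∈ t, f x ≤ f y) : ∏ x ∈ s, f x ≤ ∏ y ∈ t, f y := by
  let e := Finset.equivOfCardEq hcard
  rw [← Finset.prod_coe_sort s, ← Finset.prod_coe_sort t, ← e.prod_comp]
  exact Finset.prod_le_prod (fun x _ => hnonneg x x.2) fun x _ => hle x x.2 (e x) (e x).2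

/-- Base case of the PGM approximation lemma: within a partition whose access costs
lie in `[2^j, 2^{j+1})`, the `k` datastores with smallest misindication ratios have
at most twice the access cost and at most the miss ratio of any `k`-element subset. -/
theorem stmt_16 {ι : Type*} [DecidableEq ι] (P : Finset ι) (j : ℕ) (c ρ : ι → ℝ)
    (hc : ∀ d ∈ P, (2 : ℝ) ^ j ≤ c d ∧ c d < (2 : ℝ) ^ (j + 1))
    (hρ : ∀ d ∈ P, 0 ≤ ρ d ∧ ρ d ≤ 1)
    (k : ℕ) (O : Finset ι) (hO : O ⊆ P) (hOcard : O.card = k)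
    (D : Finset ι) (hD : D ⊆ P) (hDcard : D.card = k)
    (hmin : ∀ d ∈ D, ∀ d' ∈ P \ D, ρ d ≤ ρ d') :
    (∑ d ∈ D, c d ≤ 2 * ∑ d ∈ O, c d) ∧ (∏ d ∈ D, ρ d ≤ ∏ d ∈ O, ρ d) := by
  constructor
  · calc ∑ d ∈ D, c d ≤ D.card • (2 : ℝ) ^ (j + 1) :=
          Finset.sum_le_card_nsmul _ _ _ fun d hd => (hc d (hD hd)).2.le
      _ = 2 * (O.card • (2 : ℝ) ^ j) := by
          rw [hDcard, hOcard, nsmul_eq_mul, nsmul_eq_mul]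
          ring
      _ ≤ 2 * ∑ d ∈ O, c d := by
          gcongr
          exact Finset.card_nsmul_le_sum _ _ _ fun d hd => (hc d (hO hd)).1
  · rw [← Finset.prod_inter_mul_prod_sdiff D O, ← Finset.prod_inter_mul_prod_sdiff O D,
      Finset.inter_comm O D]
    refine mul_le_mul_of_nonneg_left ?_
      (Finset.prod_nonneg fun d hd => (hρ d (hD (Finset.mem_inter.1 hd).1)).1)
    refine Finset.prod_le_prod_of_card_eq_of_forall_le
      (Finset.card_sdiff_comm (hDcard.trans hOcard.symm))
      (fun d hd => (hρ d (hD (Finset.mem_sdiff.1 hd).1)).1) fun d hd d' hd' => ?_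
    exact hmin d (Finset.mem_sdiff.1 hd).1 d' (Finset.sdiff_subset_sdiff hO subset_rfl hd')
end

section
/- Let n, d, s, k be natural numbers with d ≥ 1, s ≥ 1, 1 ≤ k and k + 1 ≤ n. For a natural number κ with 1 ≤ κ ≤ n, define σ_κ = 1 − ((n−κ)/n)^d and E(κ) = κ · Σ_{f=0}^{s} C(s,f)·σ_κ^f·(1−σ_κ)^{s−f}·(1 − ((κ−1)/κ)^f), where C(s,f) is the binomial coefficient and all fractions and powers are over the reals. Then E(k+1) ≥ E(k). -/
/-- The expectation of `1 - r ^ F` for `F` binomial with parameters `s` and `p`. -/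
lemma sum_binomial_mul_one_sub_pow (s : ℕ) (p r : ℝ) :
    ∑ f ∈ Finset.range (s + 1),
      (s.choose f : ℝ) * p ^ f * (1 - p) ^ (s - f) * (1 - r ^ f) =
        1 - (1 - p * (1 - r)) ^ s := by
  have h₁ : (1 : ℝ) = ∑ f ∈ Finset.range (s + 1), p ^ f * (1 - p) ^ (s - f) * s.choose f := by
    rw [← add_pow, add_sub_cancel, one_pow]
  rw [show 1 - p * (1 - r) = p * r + (1 - p) by ring, add_pow]
  nth_rewrite 3 [h₁]
  rw [← Finset.sum_sub_distrib]
  refine Finset.sum_congr rfl fun f _ => ?_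
  rw [mul_pow]
  ring

/-- For `p ≤ 1`, the quantity `x * (1 - (1 - p / x) ^ s)` does not decrease from `x` to `x + 1`. -/
lemma mul_one_sub_one_sub_div_pow_le {x p : ℝ} (s : ℕ) (hx : 1 ≤ x) (hp : p ≤ 1) :
    x * (1 - (1 - p / x) ^ s) ≤ (x + 1) * (1 - (1 - p / (x + 1)) ^ s) := by
  have hx₀ : 0 < x := by linarith
  have hx₁ : 0 < x + 1 := by linarith
  have hpx : 0 ≤ 1 - p / x := by
    rw [sub_nonneg, div_le_one hx₀]
    linarith
  have h := (convexOn_pow (𝕜 := ℝ) s).2 (Set.mem_Ici.2 zero_le_one) (Set.mem_Ici.2 hpx)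
    (show 0 ≤ 1 / (x + 1) by positivity) (show 0 ≤ x / (x + 1) by positivity)
    (by field_simp; ring)
  simp only [smul_eq_mul, one_pow] at h
  rw [show 1 / (x + 1) * 1 + x / (x + 1) * (1 - p / x) = 1 - p / (x + 1) by
    field_simp; ring] at h
  have h' := mul_le_mul_of_nonneg_left h hx₁.le
  rw [show (x + 1) * (1 / (x + 1) * 1 + x / (x + 1) * (1 - p / x) ^ s) =
    1 + x * (1 - p / x) ^ s by field_simp] at h'
  linarith


/-- Monotonicity of the expected number of happy agents in the number of available
bins: with `n` bins, `s` agents each sampling `d` bins, success probability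
`σ_κ = 1 − ((n−κ)/n)^d`, and
`E(κ) = κ·Σ_{f=0}^{s} C(s,f)·σ_κ^f·(1−σ_κ)^{s−f}·(1 − ((κ−1)/κ)^f)`,
one has `E(k+1) ≥ E(k)` whenever `1 ≤ k` and `k+1 ≤ n`. -/
theorem stmt_19 (n d s k : ℕ) (hd : 1 ≤ d) (hs : 1 ≤ s) (hk : 1 ≤ k)
    (hkn : k + 1 ≤ n)
    (σ : ℕ → ℝ) (hσ : ∀ κ, σ κ = 1 - (((n : ℝ) - (κ : ℝ)) / (n : ℝ)) ^ d)
    (E : ℕ → ℝ)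
    (hE : ∀ κ, E κ = (κ : ℝ) * ∑ f ∈ Finset.range (s + 1),
        (s.choose f : ℝ) * (σ κ) ^ f * (1 - σ κ) ^ (s - f) *
          (1 - (((κ : ℝ) - 1) / (κ : ℝ)) ^ f)) :
    E (k + 1) ≥ E k := by
  have hE' : ∀ κ : ℕ, 1 ≤ κ → E κ = κ * (1 - (1 - σ κ / κ) ^ s) := by
    intro κ hκ
    have hκ₀ : (κ : ℝ) ≠ 0 := by positivity
    rw [hE, sum_binomial_mul_one_sub_pow]
    congr 3
    field_simp
    ring
  have hn : (k : ℝ) + 1 ≤ n := by exact_mod_cast hkn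
  have hk' : (1 : ℝ) ≤ k := by exact_mod_cast hk
  have hσ_le : ∀ κ : ℕ, (κ : ℝ) ≤ n → σ κ ≤ 1 := by
    intro κ hκ
    rw [hσ, sub_le_self_iff]
    exact pow_nonneg (div_nonneg (sub_nonneg.2 hκ) n.cast_nonneg) d
  have hσ_mono : σ k ≤ σ (k + 1) := by
    rw [hσ, hσ]
    push_cast
    have h₀ : 0 ≤ ((n : ℝ) - (k + 1)) / n := div_nonneg (sub_nonneg.2 hn) n.cast_nonneg
    gcongr
    linarith
  have hσ₁ : σ (k + 1) ≤ 1 := hσ_le (k + 1) (by exact_mod_cast hkn)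
  rw [ge_iff_le, hE' k hk, hE' (k + 1) (by omega)]
  push_cast
  refine (mul_one_sub_one_sub_div_pow_le s hk' (hσ_le k (by linarith))).trans ?_
  have h₀ : 0 ≤ 1 - σ (k + 1) / ((k : ℝ) + 1) := by
    rw [sub_nonneg, div_le_one (by positivity)]
    linarith
  gcongr
end
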